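/- arXiv:2403.12107 — 2 statements merged into one kernel-verified Lean document; each statement's English description precedes it below -/
import Mathlib

section
/- (Limit under full automation) For every fixed K > 0 and L > 0: as Φ → 1⁻, F(K,L;Φ) → A·K and F_K(K,L;Φ) → A. -/
/-- Region-1 CES production function. -/
noncomputable def F (A σ K L Φ : ℝ) : ℝ :=
  A * (K ^ ((σ - 1) / σ) * Φ ^ (1 / σ) + L ^ ((σ - 1) / σ) * (1 - Φ) ^ (1 / σ)) ^ (σ / (σ - 1))

/-- Return to capital: partial derivative of `F` with respect to `K`. -/
noncomputable def FK (A σ K L Φ : ℝ) : ℝ := deriv (fun K' => F A σ K' L Φ) K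

/-- The CES aggregate inside the outer power tends to its capital term as `Φ → 1`. -/
lemma tendsto_ces_aggregate {σ : ℝ} (hσ0 : 0 < σ) (a b : ℝ) :
    Filter.Tendsto (fun Φ : ℝ => a * Φ ^ (1 / σ) + b * (1 - Φ) ^ (1 / σ))
      (nhdsWithin 1 (Set.Ioo 0 1)) (nhds a) := by
  have hs : 0 < 1 / σ := by positivity
  have hcont : Continuous fun Φ : ℝ => a * Φ ^ (1 / σ) + b * (1 - Φ) ^ (1 / σ) :=
    (continuous_const.mul (Real.continuous_rpow_const hs.le)).add
      (continuous_const.mul ((Real.continuous_rpow_const hs.le).comp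
        (continuous_const.sub continuous_id)))
  have h := hcont.tendsto 1
  simp only [Real.one_rpow, sub_self, Real.zero_rpow hs.ne', mul_one, mul_zero, add_zero] at h
  exact h.mono_left nhdsWithin_le_nhds

/-- Closed form of the return to capital. -/
lemma FK_eq {A σ K L Φ : ℝ} (hσ0 : 0 < σ) (hσ1 : σ < 1) (hK : 0 < K) (hL : 0 < L)
    (hΦ : Φ ∈ Set.Ioo (0 : ℝ) 1) :
    FK A σ K L Φ = A * (Φ ^ (1 / σ) * K ^ ((σ - 1) / σ - 1) *
      (K ^ ((σ - 1) / σ) * Φ ^ (1 / σ) + L ^ ((σ - 1) / σ) * (1 - Φ) ^ (1 / σ)) ^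
        (σ / (σ - 1) - 1)) := by
  have h1 : 0 < Φ ^ (1 / σ) := Real.rpow_pos_of_pos hΦ.1 _
  have h2 : 0 < (1 - Φ) ^ (1 / σ) := Real.rpow_pos_of_pos (sub_pos.2 hΦ.2) _
  have h3 : 0 < K ^ ((σ - 1) / σ) * Φ ^ (1 / σ) + L ^ ((σ - 1) / σ) * (1 - Φ) ^ (1 / σ) := by
    positivity
  have hσ : σ - 1 ≠ 0 := (sub_neg.2 hσ1).ne
  have hr : (σ - 1) / σ * (σ / (σ - 1)) = 1 := by field_simp
  have hd := (((((Real.hasDerivAt_rpow_const (p := (σ - 1) / σ) (Or.inl hK.ne')).mul_const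
    (Φ ^ (1 / σ))).add_const (L ^ ((σ - 1) / σ) * (1 - Φ) ^ (1 / σ))).rpow_const
      (p := σ / (σ - 1)) (Or.inl h3.ne')).const_mul A)
  refine hd.deriv.trans ?_
  linear_combination (A * (Φ ^ (1 / σ) * K ^ ((σ - 1) / σ - 1) *
    (K ^ ((σ - 1) / σ) * Φ ^ (1 / σ) + L ^ ((σ - 1) / σ) * (1 - Φ) ^ (1 / σ)) ^
      (σ / (σ - 1) - 1))) * hr

theorem stmt11 (A σ K L : ℝ) (hA : 0 < A) (hσ0 : 0 < σ) (hσ1 : σ < 1)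
    (hK : 0 < K) (hL : 0 < L) :
    Filter.Tendsto (fun Φ => F A σ K L Φ) (nhdsWithin 1 (Set.Ioo 0 1)) (nhds (A * K))
    ∧ Filter.Tendsto (fun Φ => FK A σ K L Φ) (nhdsWithin 1 (Set.Ioo 0 1)) (nhds A) := by
  have hσ : σ - 1 ≠ 0 := (sub_neg.2 hσ1).ne
  have hr : (σ - 1) / σ * (σ / (σ - 1)) = 1 := by field_simp
  have hKr : K ^ ((σ - 1) / σ) ≠ 0 := (Real.rpow_pos_of_pos hK _).ne'
  have hagg := tendsto_ces_aggregate hσ0 (K ^ ((σ - 1) / σ)) (L ^ ((σ - 1) / σ))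
  constructor
  · have h := (hagg.rpow_const (p := σ / (σ - 1)) (Or.inl hKr)).const_mul A
    rwa [← Real.rpow_mul hK.le, hr, Real.rpow_one] at h
  · have hΦ : Filter.Tendsto (fun Φ : ℝ => Φ ^ (1 / σ)) (nhdsWithin 1 (Set.Ioo 0 1))
        (nhds 1) := by
      simpa using tendsto_ces_aggregate hσ0 1 0
    have h := ((hΦ.mul_const (K ^ ((σ - 1) / σ - 1))).mul
      (hagg.rpow_const (p := σ / (σ - 1) - 1) (Or.inl hKr))).const_mul A
    have hexp : (σ - 1) / σ - 1 + (σ - 1) / σ * (σ / (σ - 1) - 1) = 0 := by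
      linear_combination hr
    rw [← Real.rpow_mul hK.le, one_mul, ← Real.rpow_add hK, hexp, Real.rpow_zero, mul_one] at h
    refine h.congr' ?_
    filter_upwards [self_mem_nhdsWithin] with Φ hmem
    exact (FK_eq hσ0 hσ1 hK hL hmem).symm
end

section
/- (Wage growth decomposition) Let K : ℝ → (0,∞) and Φ : ℝ → (0,1) be differentiable, fix L > 0, and set Y(t) = F(K(t),L;Φ(t)) and w(t) = F_L(K(t),L;Φ(t)). Then w is differentiable and for every t, w'(t)/w(t) = (1/σ)·(Y'(t)/Y(t)) − (1/σ)·Φ'(t)/(1−Φ(t)). -/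
/-- Wage: partial derivative of `F` with respect to `L`. -/
noncomputable def FL (A σ K L Φ : ℝ) : ℝ := deriv (fun L' => F A σ K L' Φ) L

theorem ces_aggregate_pos {σ K L Φ : ℝ} (hK : 0 < K) (hL : 0 < L) (hΦ : Φ ∈ Set.Ioo (0 : ℝ) 1) :
    0 < K ^ ((σ - 1) / σ) * Φ ^ (1 / σ) + L ^ ((σ - 1) / σ) * (1 - Φ) ^ (1 / σ) := by
  have h0 := hΦ.1
  have h1 : 0 < 1 - Φ := sub_pos.2 hΦ.2
  positivity

theorem F_pos {A σ K L Φ : ℝ} (hA : 0 < A) (hK : 0 < K) (hL : 0 < L)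
    (hΦ : Φ ∈ Set.Ioo (0 : ℝ) 1) : 0 < F A σ K L Φ :=
  mul_pos hA (Real.rpow_pos_of_pos (ces_aggregate_pos hK hL hΦ) _)

/-- The wage is a constant multiple of `(Y (1 - Φ)) ^ (1 / σ)`, where `Y` is output. -/
theorem FL_eq {A σ K L Φ : ℝ} (hA : 0 < A) (hσ0 : σ ≠ 0) (hσ1 : σ ≠ 1) (hK : 0 < K) (hL : 0 < L)
    (hΦ : Φ ∈ Set.Ioo (0 : ℝ) 1) :
    FL A σ K L Φ =
      A / A ^ (1 / σ) * L ^ ((σ - 1) / σ - 1) * (F A σ K L Φ * (1 - Φ)) ^ (1 / σ) := by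
  have hS := ces_aggregate_pos (σ := σ) hK hL hΦ
  have hσ1' : σ - 1 ≠ 0 := sub_ne_zero.2 hσ1
  have h1 : 0 < 1 - Φ := sub_pos.2 hΦ.2
  have hd : HasDerivAt (fun L' => F A σ K L' Φ) _ L :=
    (((((Real.hasDerivAt_rpow_const (p := (σ - 1) / σ) (Or.inl hL.ne')).mul_const
      ((1 - Φ) ^ (1 / σ))).const_add (K ^ ((σ - 1) / σ) * Φ ^ (1 / σ))).rpow_const
      (p := σ / (σ - 1)) (Or.inl hS.ne')).const_mul A)
  have hpow : σ / (σ - 1) * (1 / σ) = σ / (σ - 1) - 1 := by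
    field_simp
    ring
  rw [FL, hd.deriv, Real.mul_rpow (F_pos hA hK hL hΦ).le h1.le, F,
    Real.mul_rpow hA.le (Real.rpow_nonneg hS.le _), ← Real.rpow_mul hS.le, hpow]
  have hA' : A ^ (1 / σ) ≠ 0 := (Real.rpow_pos_of_pos hA _).ne'
  generalize A ^ (1 / σ) = a at *
  generalize (1 - Φ) ^ (1 / σ) = b at *
  generalize L ^ ((σ - 1) / σ - 1) = l at *
  generalize (_ : ℝ) ^ (σ / (σ - 1) - 1) = s at *
  field_simp

theorem differentiable_F {A σ L : ℝ} (hL : 0 < L) {K Φ : ℝ → ℝ} (hKdiff : Differentiable ℝ K)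
    (hΦdiff : Differentiable ℝ Φ) (hKpos : ∀ t, 0 < K t)
    (hΦmem : ∀ t, Φ t ∈ Set.Ioo (0 : ℝ) 1) :
    Differentiable ℝ (fun t => F A σ (K t) L (Φ t)) := fun t =>
  (((((hKdiff t).rpow_const (Or.inl (hKpos t).ne')).mul
    ((hΦdiff t).rpow_const (Or.inl (hΦmem t).1.ne'))).add
    ((((hΦdiff t).const_sub 1).rpow_const (Or.inl (sub_pos.2 (hΦmem t).2).ne')).const_mul
      _)).rpow_const (Or.inl (ces_aggregate_pos (hKpos t) hL (hΦmem t)).ne')).const_mul A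

theorem stmt13 (A σ L : ℝ) (hA : 0 < A) (hσ0 : 0 < σ) (hσ1 : σ < 1) (hL : 0 < L)
    (K Φ : ℝ → ℝ) (hKdiff : Differentiable ℝ K) (hΦdiff : Differentiable ℝ Φ)
    (hKpos : ∀ t, 0 < K t) (hΦmem : ∀ t, Φ t ∈ Set.Ioo (0 : ℝ) 1) :
    Differentiable ℝ (fun t => FL A σ (K t) L (Φ t))
    ∧ ∀ t : ℝ,
      deriv (fun t' => FL A σ (K t') L (Φ t')) t / FL A σ (K t) L (Φ t)
        = (1 / σ) * (deriv (fun t' => F A σ (K t') L (Φ t')) t / F A σ (K t) L (Φ t))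
          - (1 / σ) * deriv Φ t / (1 - Φ t) := by
  have hw : (fun t => FL A σ (K t) L (Φ t)) = fun t =>
      A / A ^ (1 / σ) * L ^ ((σ - 1) / σ - 1) *
        (F A σ (K t) L (Φ t) * (1 - Φ t)) ^ (1 / σ) :=
    funext fun t => FL_eq hA hσ0.ne' hσ1.ne (hKpos t) hL (hΦmem t)
  have hY := differentiable_F (A := A) (σ := σ) hL hKdiff hΦdiff hKpos hΦmem
  have hYpos : ∀ t, 0 < F A σ (K t) L (Φ t) := fun t => F_pos hA (hKpos t) hL (hΦmem t)
  have hΦpos : ∀ t, 0 < 1 - Φ t := fun t => sub_pos.2 (hΦmem t).2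
  have hd := fun t => (((hY t).hasDerivAt.mul ((hΦdiff t).hasDerivAt.const_sub 1)).rpow_const
    (p := 1 / σ) (Or.inl (mul_pos (hYpos t) (hΦpos t)).ne')).const_mul
      (A / A ^ (1 / σ) * L ^ ((σ - 1) / σ - 1))
  refine ⟨hw ▸ fun t => (hd t).differentiableAt, fun t => ?_⟩
  have hc : 0 < A / A ^ (1 / σ) * L ^ ((σ - 1) / σ - 1) := by positivity
  have hdt := (hd t).deriv
  simp only [Pi.mul_apply] at hdt
  have hwt := congrFun hw t
  have hp := mul_pos (hYpos t) (hΦpos t)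
  rw [hw]
  beta_reduce at hwt
  rw [hwt]
  refine (congrArg (· / _) hdt).trans ?_
  rw [Real.rpow_sub_one hp.ne']
  have hP := (Real.rpow_pos_of_pos hp (1 / σ)).ne'
  generalize (F A σ (K t) L (Φ t) * (1 - Φ t)) ^ (1 / σ) = P at *
  generalize A / A ^ (1 / σ) * L ^ ((σ - 1) / σ - 1) = c at *
  have h1 := (hYpos t).ne'
  have h2 := (hΦpos t).ne'
  have h3 := hc.ne'
  field_simp
  ring
end
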